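/- Let d be real with 1 < d < 4 and d ≠ 2, and let ν > 0 be real with (3−d)/2 + ν > 0. Then the equal-mass one-loop bubble integral converges and (2·π^(d/2)/Γ(d/2)) · ∫₁^∞ G(d,ν,u)²·(u²−1)^((d−2)/2) du = (Γ(1−d/2)·Γ((d−1)/2+ν) / (2^(d+1)·π^(d/2)·ν·Γ((3−d)/2+ν))) · ( ψ((3−d)/2+ν) − ψ((d−1)/2+ν) ). -/

import Mathlib

open MeasureTheory Real Filter

/-- The AdS propagator, defined for real parameters `d`, `μ` and real `u > 1` by its
hypergeometric series. -/
noncomputable def adsG (d μ u : ℝ) : ℝ :=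
  Real.Gamma ((d - 1) / 2 + μ) /
      (2 * Real.pi ^ ((d - 1) / 2) * Real.Gamma (μ + 1) * (2 * u) ^ ((d - 1) / 2 + μ)) *
    ∑' n : ℕ,
      (ascPochhammer ℝ n).eval ((d - 1) / 4 + μ / 2) *
          (ascPochhammer ℝ n).eval ((d + 1) / 4 + μ / 2) /
          ((ascPochhammer ℝ n).eval (μ + 1) * (n.factorial : ℝ)) *
        u ^ (-(2 : ℝ) * n)

/-- The digamma function `ψ(x) = Γ′(x)/Γ(x)`. -/
noncomputable def digamma (x : ℝ) : ℝ := deriv Real.Gamma x / Real.Gamma x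

/-- The sum of the real power series with coefficients `f`. -/
noncomputable def powSum (f : ℕ → ℝ) (z : ℝ) : ℝ := ∑' n, f n * z ^ n

/-- The power series with coefficients `f` converges absolutely on `(-1, 1)`. -/
def UnitDiskSummable (f : ℕ → ℝ) : Prop :=
  ∀ r : ℝ, 0 < r → r < 1 → Summable fun n => |f n| * r ^ n

/-- The Taylor coefficients of the Gauss hypergeometric function. -/
noncomputable def hgCoeff (a b c : ℝ) (n : ℕ) : ℝ :=
  (ascPochhammer ℝ n).eval a * (ascPochhammer ℝ n).eval b /
    ((ascPochhammer ℝ n).eval c * (n.factorial : ℝ))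

/-- The Euler operator `z d/dz` on coefficient sequences. -/
def eulerCoeff (f : ℕ → ℝ) (n : ℕ) : ℝ := n * f n

lemma UnitDiskSummable.summable {f : ℕ → ℝ} (hf : UnitDiskSummable f) {z : ℝ} (h0 : 0 < z)
    (h1 : z < 1) : Summable fun n => f n * z ^ n := by
  refine Summable.of_norm ?_
  simpa [abs_of_pos h0] using hf z h0 h1

lemma UnitDiskSummable.eulerCoeff {f : ℕ → ℝ} (hf : UnitDiskSummable f) :
    UnitDiskSummable (eulerCoeff f) := by
  intro r h0 h1
  obtain ⟨ρ, hrρ, hρ1⟩ := exists_between h1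
  have hρ0 : 0 < ρ := h0.trans hrρ
  have ht := tendsto_self_mul_const_pow_of_lt_one (r := r / ρ) (by positivity)
    ((div_lt_one hρ0).2 hrρ)
  obtain ⟨C, hC⟩ := ht.bddAbove_range
  refine Summable.of_nonneg_of_le (fun n => by positivity) (fun n => ?_)
    ((hf ρ hρ0 hρ1).mul_left C)
  have h := hC ⟨n, rfl⟩
  have hpow : r ^ n = (r / ρ) ^ n * ρ ^ n := by
    rw [← mul_pow, div_mul_cancel₀ _ hρ0.ne']
  rw [_root_.eulerCoeff, abs_mul, Nat.abs_cast, hpow]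
  calc (n : ℝ) * |f n| * ((r / ρ) ^ n * ρ ^ n) = (n * (r / ρ) ^ n) * (|f n| * ρ ^ n) := by ring
    _ ≤ C * (|f n| * ρ ^ n) := by gcongr

lemma hasDerivAt_powSum {f : ℕ → ℝ} (hf : UnitDiskSummable f) {z : ℝ} (h0 : 0 < z) (h1 : z < 1) :
    HasDerivAt (powSum f) (powSum (eulerCoeff f) z / z) z := by
  obtain ⟨r, hzr, hr1⟩ := exists_between h1
  obtain ⟨s, hs0, hsz⟩ := exists_between h0
  have hr0 : 0 < r := h0.trans hzr
  have key := hasDerivAt_tsum_of_isPreconnected (g := fun n y => f n * y ^ n)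
    (g' := fun n y => f n * (n * y ^ (n - 1))) (t := Set.Ioo s r) (y₀ := z) (y := z)
    ((hf.eulerCoeff r hr0 hr1).mul_left s⁻¹) isOpen_Ioo isPreconnected_Ioo
    (fun n y _ => (hasDerivAt_pow n y).const_mul _) ?_ ⟨hsz, hzr⟩ (hf.summable h0 h1) ⟨hsz, hzr⟩
  · refine key.congr_deriv ?_
    rw [powSum, ← tsum_div_const]
    refine tsum_congr fun n => ?_
    rcases n with _ | n
    · simp [eulerCoeff]
    · simp only [eulerCoeff, Nat.add_sub_cancel, pow_succ]
      field_simp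
  · rintro n y ⟨hsy, hyr⟩
    have hy0 : 0 < y := hs0.trans hsy
    rcases n with _ | n
    · simp [eulerCoeff]
    · simp only [eulerCoeff, Nat.add_sub_cancel, norm_mul, Real.norm_eq_abs, abs_mul, Nat.abs_cast,
        abs_pow, abs_of_pos hy0]
      rw [inv_mul_eq_div, le_div_iff₀ hs0]
      calc |f (n + 1)| * (((n + 1 : ℕ) : ℝ) * y ^ n) * s
          = ((n + 1 : ℕ) : ℝ) * |f (n + 1)| * (y ^ n * s) := by ring
        _ ≤ ((n + 1 : ℕ) : ℝ) * |f (n + 1)| * (r ^ n * r) := by gcongr; linarith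
        _ = _ := by rw [pow_succ]

lemma ascPochhammer_eval_eq_prod_range (n : ℕ) (x : ℝ) :
    (ascPochhammer ℝ n).eval x = ∏ j ∈ Finset.range n, (x + j) := by
  induction n with
  | zero => simp
  | succ n ih => rw [ascPochhammer_succ_eval, ih, Finset.prod_range_succ]

lemma hgCoeff_pos {a b c : ℝ} (ha : 0 < a) (hb : 0 < b) (hc : 0 < c) (n : ℕ) :
    0 < hgCoeff a b c n := by
  have := ascPochhammer_pos n a ha
  have := ascPochhammer_pos n b hb
  have := ascPochhammer_pos n c hc
  unfold hgCoeff
  positivity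

lemma hgCoeff_succ (a b : ℝ) {c : ℝ} (hc : 0 < c) (n : ℕ) :
    hgCoeff a b c (n + 1) = (a + n) * (b + n) / ((n + 1) * (c + n)) * hgCoeff a b c n := by
  have := (ascPochhammer_pos n c hc).ne'
  have : c + n ≠ 0 := by positivity
  simp only [hgCoeff, ascPochhammer_succ_eval, Nat.factorial_succ, Nat.cast_mul, Nat.cast_add,
    Nat.cast_one]
  field_simp

lemma unitDiskSummable_hgCoeff {a b c : ℝ} (ha : 0 < a) (hb : 0 < b) (hc : 0 < c) :
    UnitDiskSummable (hgCoeff a b c) := by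
  intro r h0 h1
  have hpos := hgCoeff_pos ha hb hc
  refine summable_of_ratio_test_tendsto_lt_one h1
    (.of_forall fun n => by have := hpos n; positivity) ?_
  have hlim : ∀ x y : ℝ, Tendsto (fun n : ℕ => (x + n) / (y + n)) atTop (nhds 1) := by
    intro x y
    simpa using tendsto_add_mul_div_add_mul_atTop_nhds x y (1 : ℝ) one_ne_zero
  have h := ((hlim a 1).mul (hlim b c)).mul_const r
  simp only [one_mul] at h
  refine h.congr fun n => ?_
  have := hpos n
  have := hpos (n + 1)
  have : 0 < c + n := by positivity
  rw [Real.norm_of_nonneg (by positivity), Real.norm_of_nonneg (by positivity),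
    abs_of_pos (hpos n), abs_of_pos (hpos (n + 1)), hgCoeff_succ a b hc, pow_succ]
  field_simp
  ring

lemma hgCoeff_add_one_right (a b : ℝ) {c : ℝ} (hc : 0 < c) (n : ℕ) :
    (c + n) * hgCoeff a b (c + 1) n = c * hgCoeff a b c n := by
  have h1 := (ascPochhammer_pos n c hc).ne'
  have h2 := (ascPochhammer_pos n (c + 1) (by linarith)).ne'
  have h : (c + n) * (ascPochhammer ℝ n).eval c = c * (ascPochhammer ℝ n).eval (c + 1) := by
    have h3 := ascPochhammer_succ_eval n c
    rw [ascPochhammer_succ_left] at h3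
    simp only [Polynomial.eval_mul, Polynomial.eval_X, Polynomial.eval_comp, Polynomial.eval_add,
      Polynomial.eval_one] at h3
    linarith
  simp only [hgCoeff]
  field_simp
  linear_combination ((ascPochhammer ℝ n).eval a * (ascPochhammer ℝ n).eval b) * h

/-- The hypergeometric equation, written with the Euler operator. -/
lemma hypergeometric_ode {a b c : ℝ} (ha : 0 < a) (hb : 0 < b) (hc : 0 < c) {z : ℝ} (h0 : 0 < z)
    (h1 : z < 1) :
    (1 - z) * powSum (eulerCoeff (eulerCoeff (hgCoeff a b c))) z +
        (c - 1 - (a + b) * z) * powSum (eulerCoeff (hgCoeff a b c)) z =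
      a * b * z * powSum (hgCoeff a b c) z := by
  have hd := unitDiskSummable_hgCoeff ha hb hc
  have s0 := hd.summable h0 h1
  have s1 := hd.eulerCoeff.summable h0 h1
  have s2 := hd.eulerCoeff.eulerCoeff.summable h0 h1
  have hL : powSum (eulerCoeff (eulerCoeff (hgCoeff a b c))) z +
      (c - 1) * powSum (eulerCoeff (hgCoeff a b c)) z =
      ∑' n, (eulerCoeff (eulerCoeff (hgCoeff a b c)) n * z ^ n +
        (c - 1) * (eulerCoeff (hgCoeff a b c) n * z ^ n)) := by
    rw [powSum, powSum, s2.tsum_add (s1.mul_left _), tsum_mul_left]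
  have hR : z * (powSum (eulerCoeff (eulerCoeff (hgCoeff a b c))) z +
      (a + b) * powSum (eulerCoeff (hgCoeff a b c)) z + a * b * powSum (hgCoeff a b c) z) =
      ∑' n, z * (eulerCoeff (eulerCoeff (hgCoeff a b c)) n * z ^ n +
        (a + b) * (eulerCoeff (hgCoeff a b c) n * z ^ n) +
        a * b * (hgCoeff a b c n * z ^ n)) := by
    rw [powSum, powSum, powSum, tsum_mul_left,
      (s2.add (s1.mul_left _)).tsum_add (s0.mul_left _), s2.tsum_add (s1.mul_left _),
      tsum_mul_left, tsum_mul_left]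
  have hLR : ∑' n, (eulerCoeff (eulerCoeff (hgCoeff a b c)) n * z ^ n +
        (c - 1) * (eulerCoeff (hgCoeff a b c) n * z ^ n)) =
      ∑' n, z * (eulerCoeff (eulerCoeff (hgCoeff a b c)) n * z ^ n +
        (a + b) * (eulerCoeff (hgCoeff a b c) n * z ^ n) +
        a * b * (hgCoeff a b c n * z ^ n)) := by
    rw [(s2.add (s1.mul_left _)).tsum_eq_zero_add]
    simp only [eulerCoeff, Nat.cast_zero, zero_mul, mul_zero, add_zero, zero_add]
    refine tsum_congr fun n => ?_
    rw [hgCoeff_succ a b hc]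
    have : c + n ≠ 0 := by positivity
    push_cast
    field_simp
    ring
  linear_combination hL + hLR - hR

/-- A contiguous relation for the Gauss hypergeometric function. -/
lemma hypergeometric_contiguous {a b c : ℝ} (ha : 0 < a) (hb : 0 < b) (hc : 0 < c) {z : ℝ}
    (h0 : 0 < z) (h1 : z < 1) :
    (c - a - b) * powSum (hgCoeff a b c) z +
        (1 - z) * (powSum (eulerCoeff (hgCoeff a b c)) z / z) =
      (c - a) * (c - b) / c * powSum (hgCoeff a b (c + 1)) z := by
  have hd := unitDiskSummable_hgCoeff ha hb hc
  have s0 := hd.summable h0 h1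
  have s1 := hd.eulerCoeff.summable h0 h1
  have hshift : powSum (eulerCoeff (hgCoeff a b c)) z / z =
      ∑' n, eulerCoeff (hgCoeff a b c) (n + 1) * z ^ (n + 1) / z := by
    rw [powSum, s1.tsum_eq_zero_add, tsum_div_const]
    simp [eulerCoeff]
  have s1' := (summable_nat_add_iff 1).2 s1
  have key : (c - a - b) * powSum (hgCoeff a b c) z + powSum (eulerCoeff (hgCoeff a b c)) z / z
      - powSum (eulerCoeff (hgCoeff a b c)) z =
      (c - a) * (c - b) / c * powSum (hgCoeff a b (c + 1)) z := by
    rw [hshift, powSum, powSum, powSum, ← tsum_mul_left, ← tsum_mul_left,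
      ← (s0.mul_left _).tsum_add (s1'.div_const _),
      ← ((s0.mul_left _).add (s1'.div_const _)).tsum_sub s1]
    refine tsum_congr fun n => ?_
    have hcn : c + n ≠ 0 := by positivity
    have h := hgCoeff_add_one_right a b hc n
    have h' : hgCoeff a b (c + 1) n = c * hgCoeff a b c n / (c + n) := by
      rw [← h]; field_simp
    simp only [eulerCoeff]
    rw [h', hgCoeff_succ a b hc]
    push_cast
    field_simp
    ring
  rw [← key]
  field_simp
  ring

lemma hasSum_one_sub_rpow_neg (a : ℝ) {t : ℝ} (h0 : 0 < t) (h1 : t < 1) :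
    HasSum (fun n : ℕ => (ascPochhammer ℝ n).eval a / (n.factorial : ℝ) * t ^ n)
      ((1 - t) ^ (-a)) := by
  have h := (Real.one_div_one_sub_rpow_hasFPowerSeriesOnBall_zero a).hasSum (y := t)
    (by simpa [Metric.mem_eball, Real.enorm_of_nonneg h0.le] using h1)
  rw [zero_add, one_div, ← Real.rpow_neg (by linarith)] at h
  have hterm : ∀ n : ℕ, (FormalMultilinearSeries.ofScalars ℝ
      fun n : ℕ => Ring.choose (a + n - 1) n) n (fun _ => t) =
      (ascPochhammer ℝ n).eval a / (n.factorial : ℝ) * t ^ n := by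
    intro n
    have hm := Ring.factorial_nsmul_multichoose_eq_ascPochhammer a n
    rw [Polynomial.ascPochhammer_smeval_eq_eval, nsmul_eq_mul, Ring.multichoose_eq] at hm
    rw [FormalMultilinearSeries.ofScalars_apply_eq, smul_eq_mul, ← hm]
    field_simp
  simpa only [hterm] using h

lemma lintegral_beta {α β : ℝ} (hα : 0 < α) (hβ : 0 < β) :
    ∫⁻ x in Set.Ioo (0 : ℝ) 1, ENNReal.ofReal (x ^ (α - 1) * (1 - x) ^ (β - 1)) =
      ENNReal.ofReal (ProbabilityTheory.beta α β) := by
  have hB := ProbabilityTheory.beta_pos hα hβ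
  have h := ProbabilityTheory.lintegral_betaPDF_eq_one hα hβ
  rw [ProbabilityTheory.lintegral_betaPDF] at h
  have h2 : ∫⁻ x in Set.Ioo (0 : ℝ) 1, ENNReal.ofReal
      (1 / ProbabilityTheory.beta α β * x ^ (α - 1) * (1 - x) ^ (β - 1)) =
      ENNReal.ofReal (1 / ProbabilityTheory.beta α β) *
      ∫⁻ x in Set.Ioo (0 : ℝ) 1, ENNReal.ofReal (x ^ (α - 1) * (1 - x) ^ (β - 1)) := by
    rw [← lintegral_const_mul' _ _ ENNReal.ofReal_ne_top]
    refine lintegral_congr fun x => ?_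
    rw [← ENNReal.ofReal_mul (by positivity), mul_assoc]
  rw [h2] at h
  have h3 := congrArg (fun y => ENNReal.ofReal (ProbabilityTheory.beta α β) * y) h
  simp only [← mul_assoc, mul_one] at h3
  rwa [← ENNReal.ofReal_mul hB.le, mul_one_div_cancel hB.ne', ENNReal.ofReal_one, one_mul] at h3

/-- The Gauss summation theorem. -/
lemma hasSum_hgCoeff {a b c : ℝ} (ha : 0 < a) (hb : 0 < b) (hc : a + b < c) :
    HasSum (hgCoeff a b c)
      (Real.Gamma c * Real.Gamma (c - a - b) / (Real.Gamma (c - a) * Real.Gamma (c - b))) := by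
  have hcb : 0 < c - b := by linarith
  have hc0 : 0 < c := by linarith
  have hB := ProbabilityTheory.beta_pos hb hcb
  have hB' := ProbabilityTheory.beta_pos hb (show 0 < c - a - b by linarith)
  have hGamma : ∀ (x : ℝ), 0 < x → ∀ n : ℕ,
      Real.Gamma (x + n) = (ascPochhammer ℝ n).eval x * Real.Gamma x := by
    intro x hx n
    induction n with
    | zero => simp
    | succ n ih =>
      rw [Nat.cast_succ, ← add_assoc, Real.Gamma_add_one (by positivity), ih,
        ascPochhammer_succ_eval]
      ring
  have hterm : ∀ n : ℕ, ∫⁻ x in Set.Ioo (0 : ℝ) 1, ENNReal.ofReal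
      ((ascPochhammer ℝ n).eval a / (n.factorial : ℝ) * x ^ n *
        (x ^ (b - 1) * (1 - x) ^ (c - b - 1))) =
      ENNReal.ofReal (hgCoeff a b c n * ProbabilityTheory.beta b (c - b)) := by
    intro n
    have hpa := ascPochhammer_pos n a ha
    have hpc := ascPochhammer_pos n c hc0
    have hb' : hgCoeff a b c n * ProbabilityTheory.beta b (c - b) =
        (ascPochhammer ℝ n).eval a / (n.factorial : ℝ) *
          ProbabilityTheory.beta (b + n) (c - b) := by
      have : b + n + (c - b) = c + n := by ring
      have := (Real.Gamma_pos_of_pos hc0).ne'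
      rw [ProbabilityTheory.beta, ProbabilityTheory.beta, ‹b + n + (c - b) = c + n›,
        hGamma b hb, hGamma c hc0, hgCoeff, add_sub_cancel]
      field_simp
    rw [hb', ENNReal.ofReal_mul (by positivity), ← lintegral_beta (by positivity) hcb,
      ← lintegral_const_mul' _ _ ENNReal.ofReal_ne_top]
    refine setLIntegral_congr_fun measurableSet_Ioo fun x hx => ?_
    rw [← ENNReal.ofReal_mul (by positivity), add_sub_right_comm, Real.rpow_add hx.1,
      Real.rpow_natCast]
    congr 1
    ring
  have hsum : ∑' n, ENNReal.ofReal (hgCoeff a b c n * ProbabilityTheory.beta b (c - b)) =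
      ENNReal.ofReal (ProbabilityTheory.beta b (c - a - b)) := by
    rw [← lintegral_beta hb (by linarith)]
    simp_rw [← hterm]
    rw [← lintegral_tsum fun n => by fun_prop]
    refine setLIntegral_congr_fun measurableSet_Ioo fun x hx => ?_
    have hx1 : 0 < 1 - x := by linarith [hx.2]
    have hs := (hasSum_one_sub_rpow_neg a hx.1 hx.2).mul_right
      (x ^ (b - 1) * (1 - x) ^ (c - b - 1))
    have hpa := fun n => ascPochhammer_pos n a ha
    have hx0 := hx.1
    rw [← ENNReal.ofReal_tsum_of_nonneg (fun n => by have := hpa n; positivity) hs.summable,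
      hs.tsum_eq, mul_left_comm, ← Real.rpow_add hx1]
    ring_nf
  have hs := (ENNReal.hasSum_toReal (hsum.trans_ne ENNReal.ofReal_ne_top))
  rw [← ENNReal.tsum_toReal_eq fun n => ENNReal.ofReal_ne_top, hsum,
    ENNReal.toReal_ofReal hB'.le] at hs
  have hpos := fun n => (hgCoeff_pos ha hb hc0 n)
  have hs' := hs.div_const (ProbabilityTheory.beta b (c - b))
  have g1 := Real.Gamma_pos_of_pos hb
  have g2 := Real.Gamma_pos_of_pos hcb
  have g3 := Real.Gamma_pos_of_pos hc0
  have g4 := Real.Gamma_pos_of_pos (show 0 < c - a by linarith)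
  have hleft : (fun n => (ENNReal.ofReal (hgCoeff a b c n * ProbabilityTheory.beta b (c - b))).toReal /
      ProbabilityTheory.beta b (c - b)) = hgCoeff a b c := by
    funext n
    rw [ENNReal.toReal_ofReal (by have := hpos n; positivity), mul_div_cancel_right₀ _ hB.ne']
  have hright : ProbabilityTheory.beta b (c - a - b) / ProbabilityTheory.beta b (c - b) =
      Real.Gamma c * Real.Gamma (c - a - b) / (Real.Gamma (c - a) * Real.Gamma (c - b)) := by
    rw [ProbabilityTheory.beta, ProbabilityTheory.beta, show b + (c - a - b) = c - a by ring,
      show b + (c - b) = c by ring]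
    field_simp
  rwa [hleft, hright] at hs'

lemma tendsto_contiguous_nhdsLT_one {a b c : ℝ} (ha : 0 < a) (hb : 0 < b) (hac : a < c)
    (hbc : b < c) (habc : 0 < c - a - b + 1) :
    Tendsto (fun z => (c - a - b) * powSum (hgCoeff a b c) z +
        (1 - z) * (powSum (eulerCoeff (hgCoeff a b c)) z / z)) (nhdsWithin 1 (Set.Iio 1))
      (nhds (Real.Gamma c * Real.Gamma (c - a - b + 1) /
        (Real.Gamma (c - a) * Real.Gamma (c - b)))) := by
  have hc : 0 < c := ha.trans hac
  have hs := hasSum_hgCoeff ha hb (show a + b < c + 1 by linarith)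
  have h := (Real.tendsto_tsum_powerSeries_nhdsWithin_lt hs.tendsto_sum_nat).const_mul
    ((c - a) * (c - b) / c)
  have hlim : (c - a) * (c - b) / c * (Real.Gamma (c + 1) * Real.Gamma (c + 1 - a - b) /
      (Real.Gamma (c + 1 - a) * Real.Gamma (c + 1 - b))) =
      Real.Gamma c * Real.Gamma (c - a - b + 1) /
        (Real.Gamma (c - a) * Real.Gamma (c - b)) := by
    have h1 : 0 < c - a := by linarith
    have h2 : 0 < c - b := by linarith
    have g1 := Real.Gamma_pos_of_pos h1
    have g2 := Real.Gamma_pos_of_pos h2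
    rw [show c + 1 - a - b = c - a - b + 1 by ring, show c + 1 - a = c - a + 1 by ring,
      show c + 1 - b = c - b + 1 by ring, Real.Gamma_add_one hc.ne', Real.Gamma_add_one h1.ne',
      Real.Gamma_add_one h2.ne']
    field_simp
  rw [hlim] at h
  refine h.congr' ?_
  filter_upwards [Ioo_mem_nhdsLT (show (0 : ℝ) < 1 by norm_num)] with z hz
  exact (hypergeometric_contiguous ha hb hc hz.1 hz.2).symm

/-- An Abelian theorem: asymptotically proportional coefficients give asymptotically proportional
power series at the boundary point, when the reference series diverges there. -/
lemma tendsto_powSum_div_powSum {e r : ℕ → ℝ} {L : ℝ} (he : ∀ n, 0 ≤ e n)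
    (hed : UnitDiskSummable e) (hE : Tendsto (powSum e) (nhdsWithin 1 (Set.Iio 1)) atTop)
    (hr : Tendsto r atTop (nhds L)) :
    Tendsto (fun z => powSum (fun n => r n * e n) z / powSum e z) (nhdsWithin 1 (Set.Iio 1))
      (nhds L) := by
  rw [Metric.tendsto_nhds]
  intro ε hε
  obtain ⟨N, hN⟩ := (Metric.tendsto_atTop.1 hr) (ε / 2) (by positivity)
  set M := ∑ n ∈ Finset.range N, |r n - L| * e n with hM
  have hev := hE.eventually_gt_atTop (2 * M / ε)
  filter_upwards [Ioo_mem_nhdsLT (show (0 : ℝ) < 1 by norm_num), hev,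
    hE.eventually_gt_atTop 0] with z ⟨hz0, hz1⟩ hzM hzpos
  have se := hed.summable hz0 hz1
  have sb : Summable fun n => (if n < N then |r n - L| * e n else 0) + ε / 2 * (e n * z ^ n) := by
    refine Summable.add (summable_of_ne_finset_zero (s := Finset.range N) ?_) (se.mul_left _)
    intro n hn
    simp only [Finset.mem_range] at hn
    simp [hn]
  have hbound : ∀ n, |(r n - L) * e n * z ^ n| ≤
      (if n < N then |r n - L| * e n else 0) + ε / 2 * (e n * z ^ n) := by
    intro n
    have hen := he n
    rw [abs_mul, abs_mul, abs_of_nonneg hen, abs_of_nonneg (by positivity : 0 ≤ z ^ n)]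
    split_ifs with hn
    · have h1 : z ^ n ≤ 1 := pow_le_one₀ hz0.le hz1.le
      have h2 : |r n - L| * e n * z ^ n ≤ |r n - L| * e n * 1 := by gcongr
      have h3 : 0 ≤ ε / 2 * (e n * z ^ n) := by positivity
      linarith
    · have h1 := (hN n (not_lt.1 hn)).le
      rw [Real.dist_eq] at h1
      rw [zero_add, mul_assoc]
      gcongr
  have sd : Summable fun n => (r n - L) * e n * z ^ n :=
    Summable.of_norm_bounded sb hbound
  have hsplit : powSum (fun n => r n * e n) z - L * powSum e z =
      ∑' n, (r n - L) * e n * z ^ n := by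
    have h : powSum (fun n => r n * e n) z =
        ∑' n, ((r n - L) * e n * z ^ n + L * (e n * z ^ n)) :=
      tsum_congr fun n => by ring
    rw [h, sd.tsum_add (se.mul_left _), tsum_mul_left, powSum]
    ring
  have habs : |powSum (fun n => r n * e n) z - L * powSum e z| ≤ M + ε / 2 * powSum e z := by
    rw [hsplit]
    refine (tsum_of_norm_bounded (f := fun n => (r n - L) * e n * z ^ n) sb.hasSum
      hbound).trans (le_of_eq ?_)
    rw [Summable.tsum_add _ (se.mul_left _), tsum_mul_left, powSum]
    · congr 1
      rw [tsum_eq_sum (s := Finset.range N)]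
      · exact Finset.sum_congr rfl fun n hn => by simp [Finset.mem_range.1 hn]
      · intro n hn
        simp only [Finset.mem_range] at hn
        simp [hn]
    · refine summable_of_ne_finset_zero (s := Finset.range N) ?_
      intro n hn
      simp only [Finset.mem_range] at hn
      simp [hn]
  have heq : powSum (fun n => r n * e n) z / powSum e z - L =
      (powSum (fun n => r n * e n) z - L * powSum e z) / powSum e z := by
    field_simp
  rw [Real.dist_eq, heq, abs_div, abs_of_pos hzpos, div_lt_iff₀ hzpos]
  rw [div_lt_iff₀ hε] at hzM
  nlinarith

lemma tendsto_hgCoeff_succ_ratio {a b c q : ℝ} (ha : 0 < a) (hb : 0 < b) (hc : 0 < c)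
    (hq : 0 < q) (hsum : a + b + 1 = c + q) :
    Tendsto (fun n : ℕ => (n + 1) * hgCoeff a b c (n + 1) /
        ((ascPochhammer ℝ n).eval q / (n.factorial : ℝ))) atTop
      (nhds (Real.Gamma c * Real.Gamma q / (Real.Gamma a * Real.Gamma b))) := by
  have hseq : ∀ x : ℝ, 0 < x → ∀ n : ℕ, 0 < n →
      (ascPochhammer ℝ (n + 1)).eval x = (n : ℝ) ^ x * n.factorial / Real.GammaSeq x n := by
    intro x hx n hn
    have hp := ascPochhammer_pos (n + 1) x hx
    have hn' : (0 : ℝ) < n := by exact_mod_cast hn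
    rw [Real.GammaSeq, ← ascPochhammer_eval_eq_prod_range]
    field_simp
  have hlim : Tendsto (fun n : ℕ => (q + n) / (n : ℝ)) atTop (nhds 1) := by
    simpa using tendsto_add_mul_div_add_mul_atTop_nhds q 0 (1 : ℝ) one_ne_zero
  have ga := (Real.Gamma_pos_of_pos ha).ne'
  have gb := (Real.Gamma_pos_of_pos hb).ne'
  have h := ((((Real.GammaSeq_tendsto_Gamma c).mul (Real.GammaSeq_tendsto_Gamma q)).div
    ((Real.GammaSeq_tendsto_Gamma a).mul (Real.GammaSeq_tendsto_Gamma b)) (by positivity)).mul hlim)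
  rw [mul_one] at h
  refine h.congr' ?_
  filter_upwards [eventually_gt_atTop 0] with n hn
  have hn' : (0 : ℝ) < n := by exact_mod_cast hn
  have hpos : ∀ x : ℝ, 0 < x → 0 < Real.GammaSeq x n := by
    intro x hx
    have hp := ascPochhammer_pos (n + 1) x hx
    rw [Real.GammaSeq, ← ascPochhammer_eval_eq_prod_range]
    positivity
  have hGa := hpos a ha
  have hGb := hpos b hb
  have hGc := hpos c hc
  have hGq := hpos q hq
  have hpow : (n : ℝ) ^ a * (n : ℝ) ^ b * n = (n : ℝ) ^ c * (n : ℝ) ^ q := by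
    rw [← Real.rpow_add hn', ← Real.rpow_add hn', ← hsum, Real.rpow_add_one hn'.ne']
  have hq' : (ascPochhammer ℝ n).eval q = (ascPochhammer ℝ (n + 1)).eval q / (q + n) := by
    rw [ascPochhammer_succ_eval]
    field_simp
  rw [hq', hgCoeff, hseq a ha n hn, hseq b hb n hn, hseq c hc n hn, hseq q hq n hn,
    Nat.factorial_succ]
  simp only [Pi.div_apply]
  push_cast
  field_simp
  linear_combination (-1 : ℝ) * hpow

lemma tendsto_one_sub_rpow_mul_deriv_nhdsLT_one {a b c : ℝ} (ha : 0 < a) (hb : 0 < b) (hc : 0 < c)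
    (hq : 0 < 1 - (c - a - b)) :
    Tendsto (fun z => (1 - z) ^ (1 - (c - a - b)) * (powSum (eulerCoeff (hgCoeff a b c)) z / z))
      (nhdsWithin 1 (Set.Iio 1))
      (nhds (Real.Gamma c * Real.Gamma (1 - (c - a - b)) / (Real.Gamma a * Real.Gamma b))) := by
  set q := 1 - (c - a - b) with hqdef
  set e : ℕ → ℝ := fun n => (ascPochhammer ℝ n).eval q / (n.factorial : ℝ) with he
  have hepos : ∀ n, 0 < e n := fun n => by
    have := ascPochhammer_pos n q hq
    simp only [he]
    positivity
  have hE : ∀ z : ℝ, 0 < z → z < 1 → powSum e z = (1 - z) ^ (-q) := fun z h0 h1 =>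
    (hasSum_one_sub_rpow_neg q h0 h1).tsum_eq
  have hed : UnitDiskSummable e := fun r h0 h1 => by
    simpa only [abs_of_pos (hepos _)] using (hasSum_one_sub_rpow_neg q h0 h1).summable
  have hmem := Ioo_mem_nhdsLT (show (0 : ℝ) < 1 by norm_num)
  have hEtop : Tendsto (powSum e) (nhdsWithin 1 (Set.Iio 1)) atTop := by
    have h1 : Tendsto (fun z : ℝ => 1 - z) (nhdsWithin 1 (Set.Iio 1))
        (nhdsWithin 0 (Set.Ioi 0)) := by
      refine tendsto_nhdsWithin_iff.2 ⟨?_, ?_⟩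
      · have : Tendsto (fun z : ℝ => 1 - z) (nhds 1) (nhds (1 - 1)) := by
          exact (continuous_const.sub continuous_id).tendsto 1
        rw [sub_self] at this
        exact this.mono_left nhdsWithin_le_nhds
      · filter_upwards [self_mem_nhdsWithin] with z hz
        simpa using hz
    have h2 := (tendsto_rpow_neg_nhdsGT_zero (y := -q) (by linarith)).comp h1
    refine h2.congr' ?_
    filter_upwards [hmem] with z hz
    exact (hE z hz.1 hz.2).symm
  have hlim := tendsto_powSum_div_powSum (fun n => (hepos n).le) hed hEtop
    (tendsto_hgCoeff_succ_ratio ha hb hc hq (by rw [hqdef]; ring))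
  refine hlim.congr' ?_
  filter_upwards [hmem] with z ⟨hz0, hz1⟩
  have s1 := (unitDiskSummable_hgCoeff ha hb hc).eulerCoeff.summable hz0 hz1
  have hnum : powSum (fun n => (n + 1) * hgCoeff a b c (n + 1) /
      ((ascPochhammer ℝ n).eval q / (n.factorial : ℝ)) * e n) z =
      powSum (eulerCoeff (hgCoeff a b c)) z / z := by
    have h : powSum (eulerCoeff (hgCoeff a b c)) z / z =
        ∑' n, eulerCoeff (hgCoeff a b c) (n + 1) * z ^ (n + 1) / z := by
      rw [powSum, s1.tsum_eq_zero_add, tsum_div_const]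
      simp [eulerCoeff]
    rw [h, powSum]
    refine tsum_congr fun n => ?_
    have hen := (hepos n).ne'
    rw [show (ascPochhammer ℝ n).eval q / (n.factorial : ℝ) = e n from rfl,
      div_mul_cancel₀ _ hen, eulerCoeff, pow_succ]
    push_cast
    field_simp
  rw [hnum, hE z hz0 hz1, Real.rpow_neg (by linarith), div_inv_eq_mul, mul_comm]

/-- The Taylor coefficients of the hypergeometric factor of the propagator, with
`α = (d - 1) / 2`. -/
noncomputable def adsCoeff (α ν : ℝ) : ℕ → ℝ :=
  hgCoeff ((α + ν) / 2) ((α + ν + 1) / 2) (ν + 1)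

/-- The weighted Wronskian of the radial solutions of masses `μ` and `ν`, in the variable
`z = u⁻²`. -/
noncomputable def adsWronskian (α μ ν z : ℝ) : ℝ :=
  (1 - z) ^ (α + 1 / 2) * z ^ ((μ + ν) / 2) *
    ((ν - μ) / 2 * (powSum (adsCoeff α μ) z * powSum (adsCoeff α ν) z) +
      powSum (adsCoeff α μ) z * powSum (eulerCoeff (adsCoeff α ν)) z -
      powSum (adsCoeff α ν) z * powSum (eulerCoeff (adsCoeff α μ)) z)

lemma unitDiskSummable_adsCoeff {α ν : ℝ} (hα : 0 < α) (hν : 0 < ν) :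
    UnitDiskSummable (adsCoeff α ν) :=
  unitDiskSummable_hgCoeff (by positivity) (by positivity) (by positivity)

lemma hasDerivAt_adsWronskian {α μ ν z : ℝ} (hα : 0 < α) (hμ : 0 < μ) (hν : 0 < ν) (h0 : 0 < z)
    (h1 : z < 1) :
    HasDerivAt (adsWronskian α μ ν)
      ((ν ^ 2 - μ ^ 2) / 4 * z ^ ((μ + ν) / 2 - 1) * (1 - z) ^ (α - 1 / 2) *
        (powSum (adsCoeff α μ) z * powSum (adsCoeff α ν) z)) z := by
  have hdμ := unitDiskSummable_adsCoeff hα hμ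
  have hdν := unitDiskSummable_adsCoeff hα hν
  have Fμ := hasDerivAt_powSum hdμ h0 h1
  have Fν := hasDerivAt_powSum hdν h0 h1
  have Tμ := hasDerivAt_powSum hdμ.eulerCoeff h0 h1
  have Tν := hasDerivAt_powSum hdν.eulerCoeff h0 h1
  have h1z : 0 < 1 - z := by linarith
  have odeμ := hypergeometric_ode (a := (α + μ) / 2) (b := (α + μ + 1) / 2) (c := μ + 1)
    (by positivity) (by positivity) (by positivity) h0 h1
  have odeν := hypergeometric_ode (a := (α + ν) / 2) (b := (α + ν + 1) / 2) (c := ν + 1)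
    (by positivity) (by positivity) (by positivity) h0 h1
  have hp1 : HasDerivAt (fun z : ℝ => (1 - z) ^ (α + 1 / 2))
      (-1 * (α + 1 / 2) * (1 - z) ^ (α + 1 / 2 - 1)) z :=
    ((hasDerivAt_id z).const_sub 1).rpow_const (Or.inl h1z.ne')
  have hp2 : HasDerivAt (fun z : ℝ => z ^ ((μ + ν) / 2))
      ((μ + ν) / 2 * z ^ ((μ + ν) / 2 - 1)) z :=
    Real.hasDerivAt_rpow_const (Or.inl h0.ne')
  have key := (hp1.mul hp2).mul
    ((((Fμ.mul Fν).const_mul ((ν - μ) / 2)).add (Fμ.mul Tν)).sub (Fν.mul Tμ))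
  refine key.congr_deriv ?_
  have e1 : (1 - z) ^ (α + 1 / 2) = (1 - z) ^ (α - 1 / 2) * (1 - z) := by
    rw [← Real.rpow_add_one h1z.ne']; ring_nf
  have e2 : z ^ ((μ + ν) / 2) = z ^ ((μ + ν) / 2 - 1) * z := by
    rw [← Real.rpow_add_one h0.ne']; ring_nf
  have e3 : α + 1 / 2 - 1 = α - 1 / 2 := by ring
  simp only [Pi.mul_apply, Pi.add_apply, Pi.sub_apply]
  rw [e3, e1, e2]
  simp only [← adsCoeff.eq_def] at odeμ odeν
  generalize (1 - z) ^ (α - 1 / 2) = A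
  generalize z ^ ((μ + ν) / 2 - 1) = B
  generalize powSum (adsCoeff α μ) z = f at *
  generalize powSum (adsCoeff α ν) z = g at *
  generalize powSum (eulerCoeff (adsCoeff α μ)) z = f1 at *
  generalize powSum (eulerCoeff (adsCoeff α ν)) z = g1 at *
  generalize powSum (eulerCoeff (eulerCoeff (adsCoeff α μ))) z = f2 at *
  generalize powSum (eulerCoeff (eulerCoeff (adsCoeff α ν))) z = g2 at *
  field_simp
  linear_combination (16 * A * B * f) * odeν - (16 * A * B * g) * odeμ

/-- The limit at `z = 1` of the regular combination of the hypergeometric factor and its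
derivative. -/
noncomputable def adsRegular (α ν : ℝ) : ℝ :=
  Real.Gamma (ν + 1) * Real.Gamma (3 / 2 - α) /
    (Real.Gamma ((ν + 2 - α) / 2) * Real.Gamma ((ν + 1 - α) / 2))

/-- The coefficient of the leading singularity at `z = 1` of the derivative of the hypergeometric
factor. -/
noncomputable def adsSingular (α ν : ℝ) : ℝ :=
  Real.Gamma (ν + 1) * Real.Gamma (α + 1 / 2) /
    (Real.Gamma ((α + ν) / 2) * Real.Gamma ((α + ν + 1) / 2))

lemma tendsto_adsRegular {α ν : ℝ} (hα : 0 < α) (hα' : α < 3 / 2) (hν : 0 < ν)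
    (hν' : 0 < ν + 1 - α) :
    Tendsto (fun z => (1 / 2 - α) * powSum (adsCoeff α ν) z +
        (1 - z) * (powSum (eulerCoeff (adsCoeff α ν)) z / z)) (nhdsWithin 1 (Set.Iio 1))
      (nhds (adsRegular α ν)) := by
  have h := tendsto_contiguous_nhdsLT_one (a := (α + ν) / 2) (b := (α + ν + 1) / 2) (c := ν + 1)
    (by positivity) (by positivity) (by linarith) (by linarith) (by linarith)
  rw [show ν + 1 - (α + ν) / 2 - (α + ν + 1) / 2 = 1 / 2 - α by ring,
    show 1 / 2 - α + 1 = 3 / 2 - α by ring, show ν + 1 - (α + ν) / 2 = (ν + 2 - α) / 2 by ring,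
    show ν + 1 - (α + ν + 1) / 2 = (ν + 1 - α) / 2 by ring] at h
  exact h

lemma tendsto_adsSingular {α ν : ℝ} (hα : 0 < α) (hν : 0 < ν) :
    Tendsto (fun z => (1 - z) ^ (α + 1 / 2) * (powSum (eulerCoeff (adsCoeff α ν)) z / z))
      (nhdsWithin 1 (Set.Iio 1)) (nhds (adsSingular α ν)) := by
  have h := tendsto_one_sub_rpow_mul_deriv_nhdsLT_one (a := (α + ν) / 2) (b := (α + ν + 1) / 2)
    (c := ν + 1) (by positivity) (by positivity) (by positivity) (by linarith)
  rw [show 1 - (ν + 1 - (α + ν) / 2 - (α + ν + 1) / 2) = α + 1 / 2 by ring] at h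
  exact h

lemma tendsto_adsWronskian_one {α μ ν : ℝ} (hα : 0 < α) (hα' : α < 3 / 2) (hα2 : α ≠ 1 / 2)
    (hμ : 0 < μ) (hμ' : 0 < μ + 1 - α) (hν : 0 < ν) (hν' : 0 < ν + 1 - α) :
    Tendsto (adsWronskian α μ ν) (nhdsWithin 1 (Set.Iio 1))
      (nhds ((adsRegular α μ * adsSingular α ν - adsRegular α ν * adsSingular α μ) /
        (1 / 2 - α))) := by
  have hδ : 1 / 2 - α ≠ 0 := fun h => hα2 (by linarith)
  have Pμ := tendsto_adsRegular hα hα' hμ hμ'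
  have Pν := tendsto_adsRegular hα hα' hν hν'
  have Xμ := tendsto_adsSingular hα hμ
  have Xν := tendsto_adsSingular hα hν
  have hid : Tendsto (fun z : ℝ => z) (nhdsWithin 1 (Set.Iio 1)) (nhds 1) :=
    tendsto_nhdsWithin_of_tendsto_nhds tendsto_id
  have h1z : Tendsto (fun z : ℝ => 1 - z) (nhdsWithin 1 (Set.Iio 1)) (nhds 0) := by
    simpa using hid.const_sub 1
  have hpow : ∀ p : ℝ, 0 < p →
      Tendsto (fun z : ℝ => (1 - z) ^ p) (nhdsWithin 1 (Set.Iio 1)) (nhds 0) := fun p hp => by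
    simpa [Real.zero_rpow hp.ne'] using h1z.rpow_const (p := p) (Or.inr hp.le)
  have hz : Tendsto (fun z : ℝ => z ^ ((μ + ν) / 2)) (nhdsWithin 1 (Set.Iio 1)) (nhds 1) := by
    simpa using hid.rpow_const (p := (μ + ν) / 2) (Or.inl one_ne_zero)
  have hFF := (((((hpow (α + 1 / 2) (by linarith)).mul (Pμ.mul Pν)).sub
    (h1z.mul ((Pμ.mul Xν).add (Pν.mul Xμ)))).add
    ((hpow (3 / 2 - α) (by linarith)).mul (Xμ.mul Xν))).div_const ((1 / 2 - α) ^ 2)).const_mul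
    ((ν - μ) / 2)
  have hall := hz.mul (hFF.add (hid.mul (((Pμ.mul Xν).sub (Pν.mul Xμ)).div_const (1 / 2 - α))))
  refine (hall.congr' ?_).trans (le_of_eq (by congr 1; simp))
  filter_upwards [self_mem_nhdsWithin,
    nhdsWithin_le_nhds (lt_mem_nhds (show (0 : ℝ) < 1 by norm_num))] with z hz1 hz0
  have h1z : 0 < 1 - z := by simpa using hz1
  have e : (1 - z) ^ (3 / 2 - α) * (1 - z) ^ (α + 1 / 2) = (1 - z) ^ 2 := by
    rw [← Real.rpow_add h1z, show 3 / 2 - α + (α + 1 / 2) = (2 : ℕ) by push_cast; ring,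
      Real.rpow_natCast]
  unfold adsWronskian
  generalize (1 - z) ^ (3 / 2 - α) = B at *
  generalize (1 - z) ^ (α + 1 / 2) = A at *
  generalize z ^ ((μ + ν) / 2) = Z
  generalize powSum (adsCoeff α μ) z = f
  generalize powSum (adsCoeff α ν) z = g
  generalize powSum (eulerCoeff (adsCoeff α μ)) z = f1
  generalize powSum (eulerCoeff (adsCoeff α ν)) z = g1
  generalize hδe : 1 / 2 - α = δ at *
  field_simp
  linear_combination (Z * A * f1 * g1 * (ν - μ)) * e

lemma tendsto_powSum_zero {f : ℕ → ℝ} (hf : UnitDiskSummable f) :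
    Tendsto (powSum f) (nhdsWithin 0 (Set.Ioi 0)) (nhds (powSum f 0)) := by
  refine tendsto_tsum_of_dominated_convergence (hf (1 / 2) (by norm_num) (by norm_num))
    (fun n => tendsto_nhdsWithin_of_tendsto_nhds ?_) ?_
  · exact (continuous_const.mul (continuous_pow n)).tendsto 0
  · filter_upwards [self_mem_nhdsWithin,
      nhdsWithin_le_nhds (gt_mem_nhds (show (0 : ℝ) < 1 / 2 by norm_num))] with z hz0 hz n
    have hz0 : 0 < z := hz0
    rw [norm_mul, norm_pow, Real.norm_eq_abs, Real.norm_eq_abs, abs_of_pos hz0]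
    gcongr

lemma tendsto_adsWronskian_zero {α μ ν : ℝ} (hα : 0 < α) (hμ : 0 < μ) (hν : 0 < ν) :
    Tendsto (adsWronskian α μ ν) (nhdsWithin 0 (Set.Ioi 0)) (nhds 0) := by
  have hdμ := unitDiskSummable_adsCoeff hα hμ
  have hdν := unitDiskSummable_adsCoeff hα hν
  have Fμ := tendsto_powSum_zero hdμ
  have Fν := tendsto_powSum_zero hdν
  have Tμ := tendsto_powSum_zero hdμ.eulerCoeff
  have Tν := tendsto_powSum_zero hdν.eulerCoeff
  have hid : Tendsto (fun z : ℝ => z) (nhdsWithin 0 (Set.Ioi 0)) (nhds 0) :=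
    tendsto_nhdsWithin_of_tendsto_nhds tendsto_id
  have hz : Tendsto (fun z : ℝ => z ^ ((μ + ν) / 2)) (nhdsWithin 0 (Set.Ioi 0)) (nhds 0) := by
    have := hid.rpow_const (p := (μ + ν) / 2) (Or.inr (by positivity))
    rwa [Real.zero_rpow (by positivity)] at this
  have h1 : Tendsto (fun z : ℝ => (1 - z) ^ (α + 1 / 2)) (nhdsWithin 0 (Set.Ioi 0)) (nhds 1) := by
    simpa using (hid.const_sub 1).rpow_const (p := α + 1 / 2) (Or.inl (by norm_num))
  have := (h1.mul hz).mul ((((Fμ.mul Fν).const_mul ((ν - μ) / 2)).add (Fμ.mul Tν)).sub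
    (Fν.mul Tμ))
  rw [mul_zero, zero_mul] at this
  exact this

lemma integral_Ioi_deriv_of_nonneg_of_tendsto {g g' : ℝ → ℝ} {a l m : ℝ}
    (ha : Tendsto g (nhdsWithin a (Set.Ioi a)) (nhds l))
    (hderiv : ∀ x ∈ Set.Ioi a, HasDerivAt g (g' x) x) (hpos : ∀ x ∈ Set.Ioi a, 0 ≤ g' x)
    (hg : Tendsto g atTop (nhds m)) :
    IntegrableOn g' (Set.Ioi a) ∧ ∫ x in Set.Ioi a, g' x = m - l := by
  have hcont : ContinuousWithinAt (Function.update g a l) (Set.Ici a) a := by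
    rw [continuousWithinAt_update_same, Set.Ici_sdiff_left]
    exact ha
  have hd : ∀ x ∈ Set.Ioi a, HasDerivAt (Function.update g a l) (g' x) x := fun x hx =>
    (hderiv x hx).congr_of_eventuallyEq <| by
      filter_upwards [lt_mem_nhds hx] with y hy
      exact Function.update_of_ne (ne_of_gt hy) _ _
  have hlim : Tendsto (Function.update g a l) atTop (nhds m) :=
    hg.congr' <| by
      filter_upwards [eventually_gt_atTop a] with y hy
      exact (Function.update_of_ne (ne_of_gt hy) _ _).symm
  refine ⟨integrableOn_Ioi_deriv_of_nonneg hcont hd hpos hlim, ?_⟩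
  rw [integral_Ioi_of_hasDerivAt_of_nonneg hcont hd hpos hlim, Function.update_self]

/-- The normalisation of the propagator. -/
noncomputable def adsNorm (α ν : ℝ) : ℝ :=
  Real.Gamma (α + ν) / (2 * Real.pi ^ α * Real.Gamma (ν + 1) * 2 ^ (α + ν))

lemma adsG_eq {d ν u : ℝ} (hu : 0 < u) :
    adsG d ν u = adsNorm ((d - 1) / 2) ν *
      (u ^ (-((d - 1) / 2 + ν)) * powSum (adsCoeff ((d - 1) / 2) ν) (u ^ 2)⁻¹) := by
  have hs : ∀ n : ℕ, u ^ (-(2 : ℝ) * n) = (u ^ 2)⁻¹ ^ n := fun n => by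
    rw [Real.rpow_mul hu.le, Real.rpow_natCast, Real.rpow_neg hu.le]
    norm_num
  simp only [adsG, hs]
  rw [Real.mul_rpow zero_le_two hu.le, Real.rpow_neg hu.le, adsNorm, powSum, adsCoeff,
    show (d - 1) / 4 + ν / 2 = ((d - 1) / 2 + ν) / 2 by ring,
    show (d + 1) / 4 + ν / 2 = ((d - 1) / 2 + ν + 1) / 2 by ring]
  simp only [hgCoeff]
  field_simp

lemma adsNorm_pos {α ν : ℝ} (hα : 0 < α) (hν : 0 < ν) : 0 < adsNorm α ν := by
  have := Real.Gamma_pos_of_pos (show 0 < α + ν by positivity)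
  have := Real.Gamma_pos_of_pos (show 0 < ν + 1 by positivity)
  have := Real.pi_pos
  unfold adsNorm
  positivity

lemma powSum_adsCoeff_nonneg {α ν z : ℝ} (hα : 0 < α) (hν : 0 < ν) (hz : 0 ≤ z) :
    0 ≤ powSum (adsCoeff α ν) z :=
  tsum_nonneg fun n => mul_nonneg
    (hgCoeff_pos (by positivity) (by positivity) (by positivity) n).le (pow_nonneg hz n)

lemma adsG_nonneg {d ν u : ℝ} (hd : 1 < d) (hν : 0 < ν) (hu : 0 < u) : 0 ≤ adsG d ν u := by
  have hα : 0 < (d - 1) / 2 := by linarith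
  rw [adsG_eq hu]
  have := adsNorm_pos hα hν
  have := powSum_adsCoeff_nonneg hα hν (show 0 ≤ (u ^ 2)⁻¹ by positivity)
  positivity

/-- The integrand of the bubble with two propagators of masses `μ` and `ν`. -/
noncomputable def bubbleIntegrand (d μ ν u : ℝ) : ℝ :=
  adsG d μ u * adsG d ν u * (u ^ 2 - 1) ^ ((d - 2) / 2)

lemma bubbleIntegrand_nonneg {d μ ν u : ℝ} (hd : 1 < d) (hμ : 0 < μ) (hν : 0 < ν) (hu : 1 < u) :
    0 ≤ bubbleIntegrand d μ ν u := by
  have h0 : 0 < u := by linarith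
  refine mul_nonneg (mul_nonneg (adsG_nonneg hd hμ h0) (adsG_nonneg hd hν h0))
    (Real.rpow_nonneg (by nlinarith) _)

lemma bubbleIntegrand_eq {d μ ν u : ℝ} (hu : 1 < u) :
    bubbleIntegrand d μ ν u = adsNorm ((d - 1) / 2) μ * adsNorm ((d - 1) / 2) ν *
      (u ^ (-1 - μ - ν) * (1 - (u ^ 2)⁻¹) ^ ((d - 1) / 2 - 1 / 2) *
        (powSum (adsCoeff ((d - 1) / 2) μ) (u ^ 2)⁻¹ *
          powSum (adsCoeff ((d - 1) / 2) ν) (u ^ 2)⁻¹)) := by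
  have h0 : 0 < u := by linarith
  have hz : (u ^ 2)⁻¹ < 1 := inv_lt_one_of_one_lt₀ (by nlinarith)
  have e1 : (u ^ 2 - 1) ^ ((d - 2) / 2) =
      u ^ (d - 2) * (1 - (u ^ 2)⁻¹) ^ ((d - 1) / 2 - 1 / 2) := by
    rw [show u ^ 2 - 1 = u ^ 2 * (1 - (u ^ 2)⁻¹) by field_simp,
      Real.mul_rpow (by positivity) (by linarith), ← Real.rpow_natCast u 2,
      ← Real.rpow_mul h0.le]
    push_cast
    ring_nf
  have e2 : u ^ (-1 - μ - ν) =
      u ^ (-((d - 1) / 2 + μ)) * u ^ (-((d - 1) / 2 + ν)) * u ^ (d - 2) := by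
    rw [← Real.rpow_add h0, ← Real.rpow_add h0]
    ring_nf
  rw [bubbleIntegrand, adsG_eq h0, adsG_eq h0, e1, e2]
  ring

lemma hasDerivAt_adsWronskian_inv_sq {d μ ν u : ℝ} (hd : 1 < d) (hμ : 0 < μ) (hν : 0 < ν)
    (hu : 1 < u) :
    HasDerivAt (fun u => 2 * adsNorm ((d - 1) / 2) μ * adsNorm ((d - 1) / 2) ν *
        adsWronskian ((d - 1) / 2) μ ν (u ^ 2)⁻¹)
      ((μ ^ 2 - ν ^ 2) * bubbleIntegrand d μ ν u) u := by
  have h0 : 0 < u := by linarith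
  have hz : (u ^ 2)⁻¹ < 1 := inv_lt_one_of_one_lt₀ (by nlinarith)
  have hW := hasDerivAt_adsWronskian (α := (d - 1) / 2) (by linarith) hμ hν
    (show 0 < (u ^ 2)⁻¹ by positivity) hz
  have hinv : HasDerivAt (fun u : ℝ => (u ^ 2)⁻¹) (-(2 * u) / (u ^ 2) ^ 2) u := by
    have h := (hasDerivAt_pow 2 u).inv (by positivity)
    simp only [Nat.cast_ofNat, Nat.add_one_sub_one, pow_one] at h
    exact h
  have key := (hW.comp u hinv).const_mul
    (2 * adsNorm ((d - 1) / 2) μ * adsNorm ((d - 1) / 2) ν)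
  refine key.congr_deriv ?_
  have e : (u ^ 2)⁻¹ ^ ((μ + ν) / 2 - 1) = u ^ (-1 - μ - ν) * u ^ 3 := by
    rw [← Real.rpow_natCast u 3, ← Real.rpow_add h0, ← Real.rpow_natCast u 2,
      ← Real.rpow_neg h0.le, ← Real.rpow_mul h0.le]
    push_cast
    ring_nf
  rw [bubbleIntegrand_eq hu, e]
  field_simp
  ring

lemma integral_bubbleIntegrand_wronskian {d μ ν : ℝ} (hd1 : 1 < d) (hd4 : d < 4) (hd2 : d ≠ 2)
    (hν : 0 < ν) (hν' : 0 < (3 - d) / 2 + ν) (hμν : ν < μ) :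
    IntegrableOn (bubbleIntegrand d μ ν) (Set.Ioi 1) ∧
    ∫ u in Set.Ioi (1 : ℝ), bubbleIntegrand d μ ν u =
      2 * adsNorm ((d - 1) / 2) μ * adsNorm ((d - 1) / 2) ν *
        ((adsRegular ((d - 1) / 2) ν * adsSingular ((d - 1) / 2) μ -
          adsRegular ((d - 1) / 2) μ * adsSingular ((d - 1) / 2) ν) / (1 / 2 - (d - 1) / 2)) /
        (μ ^ 2 - ν ^ 2) := by
  have hα : 0 < (d - 1) / 2 := by linarith
  have hμ : 0 < μ := hν.trans hμν
  have hsq : 0 < μ ^ 2 - ν ^ 2 := by nlinarith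
  have hone : Tendsto (fun u : ℝ => (u ^ 2)⁻¹) (nhdsWithin 1 (Set.Ioi 1))
      (nhdsWithin 1 (Set.Iio 1)) := by
    refine tendsto_nhdsWithin_iff.2 ⟨tendsto_nhdsWithin_of_tendsto_nhds ?_, ?_⟩
    · have : ContinuousAt (fun u : ℝ => (u ^ 2)⁻¹) 1 :=
        (continuousAt_id.pow 2).inv₀ (by norm_num)
      simpa [ContinuousAt] using this
    · filter_upwards [self_mem_nhdsWithin] with u hu
      have hu : 1 < u := hu
      exact inv_lt_one_of_one_lt₀ (one_lt_pow₀ hu two_ne_zero)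
  have htop : Tendsto (fun u : ℝ => (u ^ 2)⁻¹) atTop (nhdsWithin 0 (Set.Ioi 0)) :=
    tendsto_inv_atTop_nhdsGT_zero.comp (tendsto_pow_atTop two_ne_zero)
  have hl := ((tendsto_adsWronskian_one hα (by linarith) (fun h => hd2 (by linarith)) hμ
    (by linarith) hν (by linarith)).comp hone).const_mul
      (2 * adsNorm ((d - 1) / 2) μ * adsNorm ((d - 1) / 2) ν)
  have hm := ((tendsto_adsWronskian_zero hα hμ hν).comp htop).const_mul
      (2 * adsNorm ((d - 1) / 2) μ * adsNorm ((d - 1) / 2) ν)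
  obtain ⟨hi, he⟩ := integral_Ioi_deriv_of_nonneg_of_tendsto hl
    (fun u hu => hasDerivAt_adsWronskian_inv_sq hd1 hμ hν hu)
    (fun u hu => mul_nonneg hsq.le (bubbleIntegrand_nonneg hd1 hμ hν hu)) hm
  refine ⟨(integrable_const_mul_iff hsq.ne'.isUnit _).1 hi, ?_⟩
  rw [integral_const_mul] at he
  rw [eq_div_iff hsq.ne', mul_comm, he]
  ring

/-- The function of the mass whose divided differences give the bubble integral. -/
noncomputable def tadpole (d ν : ℝ) : ℝ :=
  Real.Gamma (1 - d / 2) * Real.Gamma ((d - 1) / 2 + ν) /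
    (2 ^ d * Real.pi ^ (d / 2) * Real.Gamma ((3 - d) / 2 + ν))

lemma adsNorm_mul_adsSingular {d ν : ℝ} (hd : 1 < d) (hν : 0 < ν) :
    adsNorm ((d - 1) / 2) ν * adsSingular ((d - 1) / 2) ν =
      Real.Gamma (d / 2) / (4 * Real.pi ^ (d / 2)) := by
  have hπ := Real.pi_pos
  have h1 := (Real.Gamma_pos_of_pos (show 0 < (d - 1) / 2 + ν by linarith)).ne'
  have h2 := (Real.Gamma_pos_of_pos (show 0 < ν + 1 by linarith)).ne'
  have hdup := Real.Gamma_mul_Gamma_add_half (((d - 1) / 2 + ν) / 2)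
  rw [show ((d - 1) / 2 + ν) / 2 + 1 / 2 = ((d - 1) / 2 + ν + 1) / 2 by ring,
    show 2 * (((d - 1) / 2 + ν) / 2) = (d - 1) / 2 + ν by ring, Real.rpow_sub two_pos,
    Real.rpow_one, Real.sqrt_eq_rpow] at hdup
  rw [adsNorm, adsSingular, hdup, show (d - 1) / 2 + 1 / 2 = d / 2 by ring,
    show Real.pi ^ (d / 2) = Real.pi ^ ((d - 1) / 2) * Real.pi ^ (1 / 2 : ℝ) by
      rw [← Real.rpow_add hπ]; ring_nf]
  generalize (d - 1) / 2 + ν = x at *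
  field_simp
  norm_num

lemma adsNorm_mul_adsRegular {d ν : ℝ} (hd2 : d ≠ 2) (hν : 0 < ν)
    (hν' : 0 < (3 - d) / 2 + ν) :
    adsNorm ((d - 1) / 2) ν * adsRegular ((d - 1) / 2) ν / (1 / 2 - (d - 1) / 2) =
      tadpole d ν := by
  have hπ := Real.pi_pos
  have hδ : 1 - d / 2 ≠ 0 := fun h => hd2 (by linarith)
  have h1 := (Real.Gamma_pos_of_pos hν').ne'
  have h2 := (Real.Gamma_pos_of_pos (show 0 < ν + 1 by linarith)).ne'
  have hdup := Real.Gamma_mul_Gamma_add_half (((3 - d) / 2 + ν) / 2)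
  rw [show ((3 - d) / 2 + ν) / 2 + 1 / 2 = (ν + 2 - (d - 1) / 2) / 2 by ring,
    show 2 * (((3 - d) / 2 + ν) / 2) = (3 - d) / 2 + ν by ring,
    show ((3 - d) / 2 + ν) / 2 = (ν + 1 - (d - 1) / 2) / 2 by ring, mul_comm,
    Real.sqrt_eq_rpow] at hdup
  have h2d : (2 : ℝ) ^ d = 2 * 2 ^ ((d - 1) / 2 + ν) * 2 ^ (1 - ((3 - d) / 2 + ν)) := by
    nth_rewrite 2 [← Real.rpow_one 2]
    rw [← Real.rpow_add two_pos, ← Real.rpow_add two_pos]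
    ring_nf
  rw [adsNorm, adsRegular, hdup, tadpole, show 3 / 2 - (d - 1) / 2 = 1 - d / 2 + 1 by ring,
    Real.Gamma_add_one hδ, show 1 / 2 - (d - 1) / 2 = 1 - d / 2 by ring, h2d,
    show Real.pi ^ (d / 2) = Real.pi ^ ((d - 1) / 2) * Real.pi ^ (1 / 2 : ℝ) by
      rw [← Real.rpow_add hπ]; ring_nf]
  generalize Real.Gamma (1 - d / 2) = G
  generalize 1 - d / 2 = δ at *
  field_simp

lemma integral_bubbleIntegrand {d μ ν : ℝ} (hd1 : 1 < d) (hd4 : d < 4) (hd2 : d ≠ 2)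
    (hν : 0 < ν) (hν' : 0 < (3 - d) / 2 + ν) (hμν : ν < μ) :
    ∫ u in Set.Ioi (1 : ℝ), bubbleIntegrand d μ ν u =
      Real.Gamma (d / 2) / (2 * Real.pi ^ (d / 2)) *
        ((tadpole d ν - tadpole d μ) / (μ ^ 2 - ν ^ 2)) := by
  have hμ := hν.trans hμν
  rw [(integral_bubbleIntegrand_wronskian hd1 hd4 hd2 hν hν' hμν).2,
    ← adsNorm_mul_adsRegular hd2 hν hν', ← adsNorm_mul_adsRegular hd2 hμ (by linarith)]
  have e1 := adsNorm_mul_adsSingular hd1 hμ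
  have e2 := adsNorm_mul_adsSingular hd1 hν
  linear_combination
    (2 * adsNorm ((d - 1) / 2) ν * adsRegular ((d - 1) / 2) ν / (1 / 2 - (d - 1) / 2) /
      (μ ^ 2 - ν ^ 2)) * e1 -
    (2 * adsNorm ((d - 1) / 2) μ * adsRegular ((d - 1) / 2) μ / (1 / 2 - (d - 1) / 2) /
      (μ ^ 2 - ν ^ 2)) * e2

lemma continuousAt_deriv_Gamma {x : ℝ} (hx : 0 < x) : ContinuousAt (deriv Real.Gamma) x := by
  have hopen : IsOpen {s : ℂ | 0 < s.re} := isOpen_lt continuous_const Complex.continuous_re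
  have hdiff : ∀ s : ℂ, 0 < s.re → DifferentiableAt ℂ Complex.Gamma s := fun s hs =>
    Complex.differentiableAt_Gamma s fun m h => by
      rw [h] at hs
      simp at hs
      linarith [m.cast_nonneg (α := ℝ)]
  have hon : DifferentiableOn ℂ Complex.Gamma {s : ℂ | 0 < s.re} := fun s hs =>
    (hdiff s hs).differentiableWithinAt
  have hc : ContinuousAt (fun y : ℝ => (deriv Complex.Gamma y).re) x :=
    Complex.continuous_re.continuousAt.comp
      (ContinuousAt.comp (f := fun y : ℝ => (y : ℂ)) (g := deriv Complex.Gamma)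
        ((hon.deriv hopen).continuousOn.continuousAt (hopen.mem_nhds (by simpa using hx)))
        Complex.continuous_ofReal.continuousAt)
  refine hc.congr ?_
  filter_upwards [lt_mem_nhds hx] with y hy
  exact ((hdiff y (by simpa using hy)).hasDerivAt.real_of_complex).deriv.symm

/-- The closed form of the equal-mass bubble integral. -/
noncomputable def bubbleValue (d ν : ℝ) : ℝ :=
  Real.Gamma (d / 2) / (2 * Real.pi ^ (d / 2)) *
    (tadpole d ν * (digamma ((3 - d) / 2 + ν) - digamma ((d - 1) / 2 + ν)) / (2 * ν))

lemma hasDerivAt_Gamma {x : ℝ} (hx : 0 < x) :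
    HasDerivAt Real.Gamma (Real.Gamma x * digamma x) x := by
  have h := (Real.differentiableAt_Gamma (s := x) fun m h => by
    linarith [m.cast_nonneg (α := ℝ)]).hasDerivAt
  rwa [digamma, mul_div_cancel₀ _ (Real.Gamma_pos_of_pos hx).ne']

lemma continuousAt_digamma {x : ℝ} (hx : 0 < x) : ContinuousAt digamma x :=
  (continuousAt_deriv_Gamma hx).div (hasDerivAt_Gamma hx).continuousAt
    (Real.Gamma_pos_of_pos hx).ne'

lemma hasDerivAt_tadpole {d ν : ℝ} (hd : 1 < d) (hν : 0 < ν) (hν' : 0 < (3 - d) / 2 + ν) :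
    HasDerivAt (tadpole d)
      (-(tadpole d ν * (digamma ((3 - d) / 2 + ν) - digamma ((d - 1) / 2 + ν)))) ν := by
  have h1 := (hasDerivAt_Gamma (show 0 < (d - 1) / 2 + ν by linarith)).comp_const_add
  have h2 := (hasDerivAt_Gamma hν').comp_const_add
  have hπ := Real.pi_pos
  have hg := (Real.Gamma_pos_of_pos hν').ne'
  refine ((h1.const_mul (Real.Gamma (1 - d / 2))).div
    (h2.const_mul (2 ^ d * Real.pi ^ (d / 2))) (by positivity)).congr_deriv ?_
  rw [tadpole]
  field_simp
  ring

lemma continuousAt_bubbleValue {d ν : ℝ} (hd : 1 < d) (hν : 0 < ν)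
    (hν' : 0 < (3 - d) / 2 + ν) : ContinuousAt (bubbleValue d) ν := by
  have hadd : ∀ c : ℝ, ContinuousAt (fun ν => c + ν) ν := fun c =>
    (continuous_const.add continuous_id).continuousAt
  have h1 : ContinuousAt (fun ν => digamma ((d - 1) / 2 + ν)) ν :=
    ContinuousAt.comp (f := fun ν => (d - 1) / 2 + ν) (continuousAt_digamma (by linarith)) (hadd _)
  have h2 : ContinuousAt (fun ν => digamma ((3 - d) / 2 + ν)) ν :=
    ContinuousAt.comp (f := fun ν => (3 - d) / 2 + ν) (continuousAt_digamma hν') (hadd _)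
  exact continuousAt_const.mul
    (((hasDerivAt_tadpole hd hν hν').continuousAt.mul (h2.sub h1)).div
      (continuousAt_const.mul continuousAt_id) (by positivity))

lemma tendsto_integral_bubbleIntegrand {d ν : ℝ} (hd1 : 1 < d) (hd4 : d < 4) (hd2 : d ≠ 2)
    (hν : 0 < ν) (hν' : 0 < (3 - d) / 2 + ν) :
    Tendsto (fun μ => ∫ u in Set.Ioi (1 : ℝ), bubbleIntegrand d μ ν u)
      (nhdsWithin ν (Set.Ioi ν)) (nhds (bubbleValue d ν)) := by
  have hs := (hasDerivAt_iff_tendsto_slope.1 (hasDerivAt_tadpole hd1 hν hν')).mono_left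
    (nhdsWithin_mono (s := Set.Ioi ν) ν fun _ hx => ne_of_gt hx)
  have hadd : Tendsto (fun μ : ℝ => μ + ν) (nhdsWithin ν (Set.Ioi ν)) (nhds (2 * ν)) := by
    rw [two_mul]
    exact tendsto_nhdsWithin_of_tendsto_nhds (tendsto_id.add_const ν)
  have h := ((hs.neg.div hadd (by positivity)).const_mul
    (Real.Gamma (d / 2) / (2 * Real.pi ^ (d / 2))))
  rw [neg_neg] at h
  refine h.congr' ?_
  filter_upwards [self_mem_nhdsWithin] with μ hμν
  have hμν : ν < μ := hμν
  have h1 : μ - ν ≠ 0 := by linarith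
  have h2 : μ + ν ≠ 0 := by linarith
  rw [integral_bubbleIntegrand hd1 hd4 hd2 hν hν' hμν, Pi.div_apply, slope_def_field,
    show μ ^ 2 - ν ^ 2 = (μ - ν) * (μ + ν) by ring]
  congr 1
  field_simp
  ring

lemma ascPochhammer_eval_mono (n : ℕ) {x y : ℝ} (hx : 0 ≤ x) (hxy : x ≤ y) :
    (ascPochhammer ℝ n).eval x ≤ (ascPochhammer ℝ n).eval y := by
  rw [ascPochhammer_eval_eq_prod_range, ascPochhammer_eval_eq_prod_range]
  exact Finset.prod_le_prod (fun j _ => by positivity) fun j _ => by linarith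

lemma hgCoeff_le {a b c A : ℝ} (ha : 0 < a) (hb : 0 < b) (hbc : b ≤ c) (haA : a ≤ A) (n : ℕ) :
    hgCoeff a b c n ≤ (ascPochhammer ℝ n).eval A / (n.factorial : ℝ) := by
  have hc := hb.trans_le hbc
  have h1 := ascPochhammer_eval_mono n ha.le haA
  have h2 := ascPochhammer_eval_mono n hb.le hbc
  have h3 := ascPochhammer_pos n c hc
  have h4 := ascPochhammer_pos n b hb
  have h5 := ascPochhammer_pos n A (ha.trans_le haA)
  have h6 : (0 : ℝ) < n.factorial := by exact_mod_cast n.factorial_pos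
  rw [hgCoeff, div_le_div_iff₀ (by positivity) h6, ← mul_assoc]
  gcongr

lemma continuousAt_powSum_adsCoeff {α ν z : ℝ} (hα : 0 < α) (hν : 0 < ν) (hν' : 0 < ν + 1 - α)
    (h0 : 0 < z) (h1 : z < 1) : ContinuousAt (fun ν => powSum (adsCoeff α ν) z) ν := by
  refine tendsto_tsum_of_dominated_convergence
    (hasSum_one_sub_rpow_neg ((α + ν + 1) / 2) h0 h1).summable (fun n => ?_) ?_
  · have hc : ∀ g : ℝ → ℝ, Continuous g →
        ContinuousAt (fun ν => (ascPochhammer ℝ n).eval (g ν)) ν := fun g hg =>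
      ((ascPochhammer ℝ n).continuous.comp hg).continuousAt
    have hne := (ascPochhammer_pos n (ν + 1) (by linarith)).ne'
    exact (((hc _ (by fun_prop)).mul (hc _ (by fun_prop))).div
      ((hc _ (by fun_prop)).mul continuousAt_const)
      (mul_ne_zero hne (by positivity))).mul continuousAt_const
  · filter_upwards [lt_mem_nhds hν, lt_mem_nhds (show α - 1 < ν by linarith),
      gt_mem_nhds (show ν < ν + 1 by linarith)] with x hx0 hxα hx1 n
    have hpos := hgCoeff_pos (show 0 < (α + x) / 2 by positivity)
      (show 0 < (α + x + 1) / 2 by positivity) (show 0 < x + 1 by positivity) n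
    rw [adsCoeff, Real.norm_of_nonneg (by positivity)]
    gcongr
    exact hgCoeff_le (by positivity) (by positivity) (by linarith) (by linarith) n

lemma continuousAt_adsG {d ν u : ℝ} (hd : 1 < d) (hν : 0 < ν) (hν' : 0 < (3 - d) / 2 + ν)
    (hu : 1 < u) : ContinuousAt (fun ν => adsG d ν u) ν := by
  have h0 : 0 < u := by linarith
  have hz : (u ^ 2)⁻¹ < 1 := inv_lt_one_of_one_lt₀ (one_lt_pow₀ hu two_ne_zero)
  have hα : 0 < (d - 1) / 2 := by linarith
  have hπ := Real.pi_pos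
  have hg := (Real.Gamma_pos_of_pos (show 0 < ν + 1 by linarith)).ne'
  have hG : ∀ g : ℝ → ℝ, Continuous g → 0 < g ν → ContinuousAt (fun ν => Real.Gamma (g ν)) ν :=
    fun g hg hpos => ContinuousAt.comp (f := g) (hasDerivAt_Gamma hpos).continuousAt hg.continuousAt
  have hpow : ∀ c : ℝ, 0 < c → ∀ g : ℝ → ℝ, Continuous g →
      ContinuousAt (fun ν => c ^ g ν) ν := fun c hc g hg =>
    (continuous_const.rpow hg fun _ => Or.inl hc.ne').continuousAt
  simp only [adsG_eq h0]
  refine ContinuousAt.mul ?_ ((hpow u h0 _ (by fun_prop)).mul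
    (continuousAt_powSum_adsCoeff hα hν (by linarith) (by positivity) hz))
  exact (hG _ (by fun_prop) (by linarith)).div ((continuousAt_const.mul
    (hG _ (by fun_prop) (by linarith))).mul (hpow 2 two_pos _ (by fun_prop))) (by positivity)

lemma integrable_and_integral_le_of_tendsto {X : Type*} [MeasurableSpace X] {m : Measure X}
    {F : ℕ → X → ℝ} {f : X → ℝ} {L : ℝ} (hF : ∀ k, Integrable (F k) m)
    (hpos : ∀ k, ∀ᵐ x ∂m, 0 ≤ F k x)
    (hlim : ∀ᵐ x ∂m, Tendsto (fun k => F k x) atTop (nhds (f x)))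
    (hconv : Tendsto (fun k => ∫ x, F k x ∂m) atTop (nhds L)) :
    Integrable f m ∧ ∫ x, f x ∂m ≤ L := by
  have hmeas : AEStronglyMeasurable f m :=
    aestronglyMeasurable_of_tendsto_ae atTop (fun k => (hF k).1) hlim
  have hfpos : 0 ≤ᵐ[m] f := by
    filter_upwards [hlim, ae_all_iff.2 hpos] with x hx hp
    exact ge_of_tendsto' hx hp
  have hL : 0 ≤ L := ge_of_tendsto' hconv fun k => integral_nonneg_of_ae (hpos k)
  have hle : ∫⁻ x, ENNReal.ofReal (f x) ∂m ≤ ENNReal.ofReal L := by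
    calc ∫⁻ x, ENNReal.ofReal (f x) ∂m
        = ∫⁻ x, liminf (fun k => ENNReal.ofReal (F k x)) atTop ∂m := by
          refine lintegral_congr_ae ?_
          filter_upwards [hlim] with x hx
          exact (ENNReal.tendsto_ofReal hx).liminf_eq.symm
      _ ≤ liminf (fun k => ∫⁻ x, ENNReal.ofReal (F k x) ∂m) atTop :=
          lintegral_liminf_le' fun k => (hF k).1.aemeasurable.ennreal_ofReal
      _ = ENNReal.ofReal L := by
          simp_rw [← fun k => ofReal_integral_eq_lintegral_ofReal (hF k) (hpos k)]
          exact (ENNReal.tendsto_ofReal hconv).liminf_eq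
  have hi : Integrable f m := by
    refine ⟨hmeas, (hasFiniteIntegral_iff_ofReal hfpos).2 (hle.trans_lt ENNReal.ofReal_lt_top)⟩
  refine ⟨hi, ?_⟩
  rw [← ofReal_integral_eq_lintegral_ofReal hi hfpos] at hle
  exact (ENNReal.ofReal_le_ofReal_iff hL).1 hle

lemma tendsto_add_one_div_nhdsGT (ν : ℝ) :
    Tendsto (fun k : ℕ => ν + 1 / ((k : ℝ) + 1)) atTop (nhdsWithin ν (Set.Ioi ν)) := by
  refine tendsto_nhdsWithin_iff.2 ⟨?_, .of_forall fun k => ?_⟩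
  · simpa using (tendsto_one_div_add_atTop_nhds_zero_nat (𝕜 := ℝ)).const_add ν
  · exact lt_add_of_pos_right ν (by positivity)

lemma integrableOn_bubbleIntegrand_self {d ν : ℝ} (hd1 : 1 < d) (hd4 : d < 4) (hd2 : d ≠ 2)
    (hν : 0 < ν) (hν' : 0 < (3 - d) / 2 + ν) :
    IntegrableOn (bubbleIntegrand d ν ν) (Set.Ioi 1) ∧
      ∫ u in Set.Ioi (1 : ℝ), bubbleIntegrand d ν ν u ≤ bubbleValue d ν := by
  have hlt : ∀ k : ℕ, ν < ν + 1 / ((k : ℝ) + 1) := fun k => lt_add_of_pos_right ν (by positivity)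
  have hmem : ∀ᵐ u : ℝ ∂volume.restrict (Set.Ioi 1), 1 < u := ae_restrict_mem measurableSet_Ioi
  have hseq := tendsto_add_one_div_nhdsGT ν
  refine integrable_and_integral_le_of_tendsto
    (F := fun k : ℕ => bubbleIntegrand d (ν + 1 / ((k : ℝ) + 1)) ν)
    (fun k => (integral_bubbleIntegrand_wronskian hd1 hd4 hd2 hν hν' (hlt k)).1) (fun k => ?_) ?_
    ((tendsto_integral_bubbleIntegrand hd1 hd4 hd2 hν hν').comp hseq)
  · filter_upwards [hmem] with u hu
    exact bubbleIntegrand_nonneg hd1 (hν.trans (hlt k)) hν hu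
  · filter_upwards [hmem] with u hu
    exact ((((continuousAt_adsG hd1 hν hν' hu).tendsto.comp
      (tendsto_nhds_of_tendsto_nhdsWithin hseq)).mul_const _).mul_const _)

lemma integral_bubbleIntegrand_self {d ν : ℝ} (hd1 : 1 < d) (hd4 : d < 4) (hd2 : d ≠ 2)
    (hν : 0 < ν) (hν' : 0 < (3 - d) / 2 + ν) :
    ∫ u in Set.Ioi (1 : ℝ), bubbleIntegrand d ν ν u = bubbleValue d ν := by
  obtain ⟨hiν, hleν⟩ := integrableOn_bubbleIntegrand_self hd1 hd4 hd2 hν hν'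
  refine le_antisymm hleν ?_
  have hle : ∀ μ, ν < μ → 2 * ∫ u in Set.Ioi (1 : ℝ), bubbleIntegrand d μ ν u ≤
      bubbleValue d μ + ∫ u in Set.Ioi (1 : ℝ), bubbleIntegrand d ν ν u := fun μ hμν => by
    obtain ⟨hiμ, hleμ⟩ :=
      integrableOn_bubbleIntegrand_self hd1 hd4 hd2 (hν.trans hμν) (by linarith)
    refine le_trans ?_ (add_le_add_left hleμ _)
    rw [← integral_add hiμ hiν, ← integral_const_mul]
    refine setIntegral_mono_on
      ((integral_bubbleIntegrand_wronskian hd1 hd4 hd2 hν hν' hμν).1.const_mul 2)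
      (hiμ.add hiν) measurableSet_Ioi fun u hu => ?_
    have hu : 1 < u := hu
    have hw : 0 ≤ (u ^ 2 - 1) ^ ((d - 2) / 2) := Real.rpow_nonneg (by nlinarith) _
    simp only [bubbleIntegrand]
    nlinarith [mul_nonneg (sq_nonneg (adsG d μ u - adsG d ν u)) hw]
  have hlim := (tendsto_integral_bubbleIntegrand hd1 hd4 hd2 hν hν').const_mul 2
  have hval : Tendsto (bubbleValue d) (nhdsWithin ν (Set.Ioi ν)) (nhds (bubbleValue d ν)) :=
    tendsto_nhdsWithin_of_tendsto_nhds (continuousAt_bubbleValue hd1 hν hν')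
  have := le_of_tendsto_of_tendsto hlim (hval.add_const _)
    (by filter_upwards [self_mem_nhdsWithin] with μ hμ using hle μ hμ)
  linarith

/-- Equal-mass one-loop bubble integral on Euclidean AdS. -/
theorem one_loop_bubble_equal_mass (d nu : ℝ) (hd1 : 1 < d) (hd4 : d < 4) (hd2 : d ≠ 2)
    (hnu : 0 < nu) (hnu' : 0 < (3 - d) / 2 + nu) :
    IntegrableOn (fun u : ℝ => adsG d nu u ^ 2 * (u ^ 2 - 1) ^ ((d - 2) / 2)) (Set.Ioi 1) ∧
    (2 * Real.pi ^ (d / 2) / Real.Gamma (d / 2)) *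
        ∫ u in Set.Ioi (1 : ℝ), adsG d nu u ^ 2 * (u ^ 2 - 1) ^ ((d - 2) / 2) =
      Real.Gamma (1 - d / 2) * Real.Gamma ((d - 1) / 2 + nu) /
          (2 ^ (d + 1) * Real.pi ^ (d / 2) * nu * Real.Gamma ((3 - d) / 2 + nu)) *
        (digamma ((3 - d) / 2 + nu) - digamma ((d - 1) / 2 + nu)) := by
  have hsq : (fun u : ℝ => adsG d nu u ^ 2 * (u ^ 2 - 1) ^ ((d - 2) / 2)) =
      bubbleIntegrand d nu nu := by
    funext u
    rw [bubbleIntegrand, sq]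
  rw [hsq]
  refine ⟨(integrableOn_bubbleIntegrand_self hd1 hd4 hd2 hnu hnu').1, ?_⟩
  have hg := (Real.Gamma_pos_of_pos (show 0 < d / 2 by linarith)).ne'
  have hg' := (Real.Gamma_pos_of_pos hnu').ne'
  have hπ := Real.pi_pos
  rw [integral_bubbleIntegrand_self hd1 hd4 hd2 hnu hnu', bubbleValue, tadpole,
    Real.rpow_add_one two_ne_zero]
  generalize digamma ((3 - d) / 2 + nu) - digamma ((d - 1) / 2 + nu) = ψ
  generalize Real.Gamma ((3 - d) / 2 + nu) = G at *
  generalize Real.Gamma (d / 2) = H at *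
  field_simp
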